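/- Let Φ be the (one-parameter) potential function over P_∞ with the constant threshold weighting θ ≡ 1. For every join-tree A over P_∞ and every finite set S ⊆ ℤ, if S intersects t distinct connected components of Gr(A), then Φ(A) ≥ Φ(A ⊖ S) + t. -/

import Mathlib

open scoped Classical

noncomputable section

namespace Paper

/-- A join-tree: a finite rooted binary tree whose leaves are labeled by
edges (elements of `Sym2 α`) or by `⊥` (here `none`). -/
inductive JoinTree (α : Type*) where
  | leaf : Option (Sym2 α) → JoinTree α
  | node : JoinTree α → JoinTree α → JoinTree α

variable {V : Type*}

/-- The vertex set of a finite edge set (a finite subgraph given by its edges). -/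
def vset (F : Finset (Sym2 V)) : Set V := {v | ∃ e ∈ F, v ∈ e}

lemma vset_mono {F F' : Finset (Sym2 V)} (h : F ⊆ F') : vset F ⊆ vset F' := by
  rintro v ⟨e, he, hv⟩
  exact ⟨e, h he, hv⟩

/-- `Δ_θ(F) = |V(F)| − Σ_{e ∈ E(F)} θ(e)`. -/
def Delta (θ : Sym2 V → ℝ) (F : Finset (Sym2 V)) : ℝ :=
  ((vset F).ncard : ℝ) - ∑ e ∈ F, θ e

/-- `θ` is a threshold weighting on the graph with edge set `E`:
it takes values in `[0,2]` on `E`, `Δ_θ(F) ≥ 0` for every finite subgraph `F ⊆ E`,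
and `Δ_θ(E) = 0` whenever `E` is finite. -/
def IsThresholdWeighting (E : Set (Sym2 V)) (θ : Sym2 V → ℝ) : Prop :=
  (∀ e ∈ E, 0 ≤ θ e ∧ θ e ≤ 2) ∧
  (∀ F : Finset (Sym2 V), (F : Set (Sym2 V)) ⊆ E → 0 ≤ Delta θ F) ∧
  (∀ hE : E.Finite, Delta θ hE.toFinset = 0)

/-- `F ⊖ S`: the union of the connected components of `F` that are vertex-disjoint
from `S`. -/
def elimS (F : Finset (Sym2 V)) (S : Set V) : Finset (Sym2 V) :=
  F.filter fun e =>
    ∀ v ∈ e, ∀ s ∈ S, ¬ (SimpleGraph.fromEdgeSet (F : Set (Sym2 V))).Reachable v s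

/-- The graph with edge set `F` is connected. -/
def ConnE (F : Finset (Sym2 V)) : Prop :=
  ∀ u ∈ vset F, ∀ w ∈ vset F, (SimpleGraph.fromEdgeSet (F : Set (Sym2 V))).Reachable u w

/-- The subgraph of `F` induced on a vertex set `T`. -/
def induced (F : Finset (Sym2 V)) (T : Set V) : Finset (Sym2 V) :=
  F.filter fun e => ∀ v ∈ e, v ∈ T

namespace JoinTree

/-- The graph of a join-tree: the finite subgraph whose edges are the labels
occurring in the tree. -/
def graph : JoinTree V → Finset (Sym2 V)
  | leaf none => ∅
  | leaf (some e) => {e}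
  | node B C => graph B ∪ graph C

/-- `Sub D A` means `D ⪯ A`: `D = ⟨⟩`, or `D = A`, or `D` is a sub-join-tree of a
child of `A`. -/
inductive Sub : JoinTree V → JoinTree V → Prop
  | empty (A : JoinTree V) : Sub (leaf none) A
  | refl (A : JoinTree V) : Sub A A
  | left {D B C : JoinTree V} : Sub D B → Sub D (node B C)
  | right {D B C : JoinTree V} : Sub D C → Sub D (node B C)

/-- `SubP D A` means `D ≺ A`, i.e. `D ⪯ A` and `D ≠ A`. -/
def SubP (D A : JoinTree V) : Prop := Sub D A ∧ D ≠ A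

/-- A join-tree is atomic if it is a single (labeled or unlabeled) leaf. -/
def Atomic (A : JoinTree V) : Prop := ∃ l, A = leaf l

/-- Replace every leaf label not belonging to `E'` by `⊥`. -/
def prune : JoinTree V → Finset (Sym2 V) → JoinTree V
  | leaf none, _ => leaf none
  | leaf (some e), E' => if e ∈ E' then leaf (some e) else leaf none
  | node B C, E' => node (prune B E') (prune C E')

/-- `A ⊖ S`: delete all leaf labels except those belonging to `Gr(A) ⊖ S`. -/
def elimT (A : JoinTree V) (S : Set V) : JoinTree V := prune A (Paper.elimS A.graph S)

/-- `A` is a join-tree over the graph with edge set `E` (all labels come from `E`). -/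
def Over (E : Set (Sym2 V)) (A : JoinTree V) : Prop := (A.graph : Set (Sym2 V)) ⊆ E

lemma graph_mono_of_sub {D A : JoinTree V} (h : Sub D A) : D.graph ⊆ A.graph := by
  induction h with
  | empty A => intro e he; simp [graph] at he
  | refl A => exact Finset.Subset.refl _
  | left _ ih => exact ih.trans Finset.subset_union_left
  | right _ ih => exact ih.trans Finset.subset_union_right

end JoinTree

open JoinTree

/-- The constraints defining the (one-parameter) potential function `Φ_θ` on
join-trees over the graph with edge set `E`: nonnegativity, the atomic base case,
inequality (†) (in both orders of the children) and inequality (‡). -/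
def PhiOk (E : Set (Sym2 V)) (θ : Sym2 V → ℝ) (f : JoinTree V → ℝ) : Prop :=
  (∀ A : JoinTree V, Over E A → 0 ≤ f A) ∧
  (∀ A : JoinTree V, Over E A → Atomic A → Delta θ A.graph ≤ f A) ∧
  (∀ B C D : JoinTree V, Over E (JoinTree.node B C) → Sub D B →
      f D + Delta θ (elimS C.graph (vset D.graph))
          + Delta θ (elimS (JoinTree.node B C).graph (vset C.graph ∪ vset D.graph))
        ≤ f (JoinTree.node B C)) ∧
  (∀ B C D : JoinTree V, Over E (JoinTree.node B C) → Sub D C →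
      f D + Delta θ (elimS B.graph (vset D.graph))
          + Delta θ (elimS (JoinTree.node B C).graph (vset B.graph ∪ vset D.graph))
        ≤ f (JoinTree.node B C)) ∧
  (∀ A D E' : JoinTree V, Over E A → SubP D A → SubP E' A →
      (f D + f (elimT E' (vset D.graph)) + Delta θ A.graph
          + Delta θ (elimS A.graph (vset D.graph ∪ vset E'.graph))) / 2 ≤ f A)

/-- The potential function `Φ_θ(A)`: the pointwise smallest function satisfying
the constraints `PhiOk`. -/
def Phi (E : Set (Sym2 V)) (θ : Sym2 V → ℝ) (A : JoinTree V) : ℝ :=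
  sInf { y | ∃ f : JoinTree V → ℝ, PhiOk E θ f ∧ y = f A }

/-- The edge set of the two-way infinite path `P_∞` on vertex set `ℤ`. -/
def EPinf : Set (Sym2 ℤ) := { e | ∃ i : ℤ, e = s(i, i + 1) }

/-- The constant threshold weighting `θ ≡ 1` on `P_∞`. -/
def theta1 : Sym2 ℤ → ℝ := fun _ => 1

/-- `P_{i,j} ⊆ F`: all edges of the path from `i` to `j` belong to `F`. -/
def pathIn (F : Finset (Sym2 ℤ)) (i j : ℤ) : Prop :=
  ∀ m : ℤ, i ≤ m → m < j → s(m, m + 1) ∈ F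

/-- `(i,j)` is an open component of `F|S`. -/
def OpenComp (F : Finset (Sym2 ℤ)) (S : Set ℤ) (i j : ℤ) : Prop :=
  i < j ∧ pathIn F i j ∧ ∀ m : ℤ, i ≤ m → m ≤ j → (m ∈ S ↔ m = i ∨ m = j)

/-- `[i,j)` is a half-open component of `F|S`. -/
def HOLComp (F : Finset (Sym2 ℤ)) (S : Set ℤ) (i j : ℤ) : Prop :=
  i < j ∧ pathIn F i j ∧ (∀ m : ℤ, i ≤ m → m ≤ j → (m ∈ S ↔ m = i)) ∧ s(j, j + 1) ∉ F

/-- `(i,j]` is a half-open component of `F|S`. -/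
def HORComp (F : Finset (Sym2 ℤ)) (S : Set ℤ) (i j : ℤ) : Prop :=
  i < j ∧ pathIn F i j ∧ (∀ m : ℤ, i ≤ m → m ≤ j → (m ∈ S ↔ m = j)) ∧ s(i - 1, i) ∉ F

/-- `[i,j]` is a closed component of `F|S`. -/
def ClosedComp (F : Finset (Sym2 ℤ)) (S : Set ℤ) (i j : ℤ) : Prop :=
  i < j ∧ pathIn F i j ∧ (∀ m : ℤ, i ≤ m → m ≤ j → m ∉ S) ∧
    s(i - 1, i) ∉ F ∧ s(j, j + 1) ∉ F

/-- The number of closed components of `F|S`. -/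
def closedCount (F : Finset (Sym2 ℤ)) (S : Set ℤ) : ℕ :=
  {p : ℤ × ℤ | ClosedComp F S p.1 p.2}.ncard

/-- `λ(F)`: the number of edges of the largest connected component of `F`
(the length of the longest path in a subgraph of `P_∞`). -/
def lamP (F : Finset (Sym2 ℤ)) : ℕ :=
  sSup { m | ∃ v ∈ vset F,
    m = (F.filter fun e =>
      ∃ u ∈ e, (SimpleGraph.fromEdgeSet (F : Set (Sym2 ℤ))).Reachable u v).card }

/-- The edge set of the path `P_k` with vertices `0, 1, …, k`. -/
def PkF (k : ℕ) : Finset (Sym2 ℤ) :=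
  (Finset.range k).image fun i => s((i : ℤ), (i : ℤ) + 1)

/-! ### Elementary facts about `vset`, `Delta` and `elimS` -/

lemma vset_finite (F : Finset (Sym2 V)) : (vset F).Finite := by
  have h : vset F = ⋃ e ∈ F, (e.toFinset : Set V) := by
    ext v
    simp [vset]
  rw [h]
  exact F.finite_toSet.biUnion fun e _ => e.toFinset.finite_toSet

lemma vset_union (F G : Finset (Sym2 V)) : vset (F ∪ G) = vset F ∪ vset G := by
  ext v
  simp only [vset, Finset.mem_union, Set.mem_union, Set.mem_ofPred_eq]
  grind

lemma mem_vset {F : Finset (Sym2 V)} {e : Sym2 V} {v : V} (he : e ∈ F) (hv : v ∈ e) :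
    v ∈ vset F := ⟨e, he, hv⟩

lemma exists_mem_sym2 (e : Sym2 V) : ∃ v, v ∈ e := by
  induction e with
  | _ x y => exact ⟨x, Sym2.mem_mk_left x y⟩

@[simp] lemma vset_empty : vset (∅ : Finset (Sym2 V)) = ∅ := by
  simp [vset]

@[simp] lemma Delta_empty (θ : Sym2 V → ℝ) : Delta θ ∅ = 0 := by
  simp [Delta]

lemma Delta_one (F : Finset (Sym2 V)) :
    Delta (fun _ => 1) F = ((vset F).ncard : ℝ) - F.card := by
  simp [Delta]

lemma elimS_subset (F : Finset (Sym2 V)) (S : Set V) : elimS F S ⊆ F :=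
  Finset.filter_subset _ _

@[simp] lemma elimS_empty (F : Finset (Sym2 V)) : elimS F (∅ : Set V) = F := by
  simp [elimS]

lemma reachable_mono {F G : Finset (Sym2 V)} (h : F ⊆ G) {u v : V}
    (huv : (SimpleGraph.fromEdgeSet (F : Set (Sym2 V))).Reachable u v) :
    (SimpleGraph.fromEdgeSet (G : Set (Sym2 V))).Reachable u v :=
  huv.mono (SimpleGraph.fromEdgeSet_mono (by exact_mod_cast h))

lemma reachable_of_mem {F : Finset (Sym2 V)} {e : Sym2 V} (he : e ∈ F) {u v : V}
    (hu : u ∈ e) (hv : v ∈ e) :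
    (SimpleGraph.fromEdgeSet (F : Set (Sym2 V))).Reachable u v := by
  by_cases huv : u = v
  · exact huv ▸ SimpleGraph.Reachable.refl _
  · have : e = s(u, v) := ((Sym2.mem_and_mem_iff huv).1 ⟨hu, hv⟩)
    refine SimpleGraph.Adj.reachable ?_
    rw [SimpleGraph.fromEdgeSet_adj]
    exact ⟨by rw [← this]; exact_mod_cast he, huv⟩

/-- A set of vertices closed under adjacency is closed under reachability. -/
lemma mem_of_reachable {G : SimpleGraph V} {T : Set V}
    (hT : ∀ u v, G.Adj u v → u ∈ T → v ∈ T) {u v : V} (h : G.Reachable u v) (hu : u ∈ T) :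
    v ∈ T := by
  obtain ⟨p⟩ := h
  induction p with
  | nil => exact hu
  | cons hadj _ ih => exact ih (hT _ _ hadj hu)

lemma sdiff_elimS_subset (F : Finset (Sym2 V)) (S : Set V) : F \ elimS F S ⊆ F :=
  Finset.sdiff_subset

lemma mem_vset_sdiff_elimS {F : Finset (Sym2 V)} {S : Set V} {v : V} (hvS : v ∈ S)
    (hv : v ∈ vset F) : v ∈ vset (F \ elimS F S) := by
  obtain ⟨e, he, hve⟩ := hv
  refine mem_vset (Finset.mem_sdiff.2 ⟨he, fun heS => ?_⟩) hve
  exact (Finset.mem_filter.1 heS).2 v hve v hvS (SimpleGraph.Reachable.refl _)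

lemma disjoint_elimS {F G : Finset (Sym2 V)} {S : Set V} (h : vset G ⊆ S) :
    Disjoint G (elimS F S) := by
  rw [Finset.disjoint_left]
  intro e heG he
  obtain ⟨v, hv⟩ := exists_mem_sym2 e
  exact (Finset.mem_filter.1 he).2 v hv v (h (mem_vset heG hv)) (SimpleGraph.Reachable.refl _)

lemma Delta_one_union_le {F G : Finset (Sym2 V)} (h : Disjoint F G) :
    Delta (fun _ => 1) (F ∪ G) ≤ Delta (fun _ => 1) F + Delta (fun _ => 1) G := by
  rw [Delta_one, Delta_one, Delta_one, vset_union, Finset.card_union_of_disjoint h]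
  have : ((vset F ∪ vset G).ncard : ℝ) ≤ (vset F).ncard + (vset G).ncard := by
    exact_mod_cast Set.ncard_union_le _ _
  push_cast
  linarith

lemma Delta_one_insert_le {F : Finset (Sym2 V)} {e : Sym2 V} (he : e ∉ F) {v : V}
    (hve : v ∈ e) (hv : v ∈ vset F) :
    Delta (fun _ => 1) (insert e F) ≤ Delta (fun _ => 1) F := by
  obtain ⟨w, rfl⟩ := hve
  have hsub : vset (insert s(v, w) F) ⊆ insert w (vset F) := by
    rintro x ⟨e', he', hx⟩
    rcases Finset.mem_insert.1 he' with rfl | he'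
    · rcases Sym2.mem_iff.1 hx with rfl | rfl
      · exact Set.mem_insert_of_mem _ hv
      · exact Set.mem_insert _ _
    · exact Set.mem_insert_of_mem _ ⟨e', he', hx⟩
  have h1 : ((vset (insert s(v, w) F)).ncard : ℝ) ≤ (vset F).ncard + 1 := by
    exact_mod_cast (Set.ncard_le_ncard hsub ((vset_finite F).insert w)).trans
      (Set.ncard_insert_le _ _)
  rw [Delta_one, Delta_one, Finset.card_insert_of_notMem he]
  push_cast
  linarith

/-- A subgraph that meets every connected component has at least as large a `Delta`. -/
lemma Delta_one_le_of_meets {X Y : Finset (Sym2 V)} (hYX : Y ⊆ X)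
    (hmeet : ∀ e ∈ X, ∃ v ∈ e, ∃ y ∈ vset Y,
      (SimpleGraph.fromEdgeSet (X : Set (Sym2 V))).Reachable v y) :
    Delta (fun _ => 1) X ≤ Delta (fun _ => 1) Y := by
  by_cases hXY : X ⊆ Y
  · rw [hYX.antisymm hXY]
  have hex : ∃ e ∈ X, e ∉ Y ∧ ∃ v ∈ e, v ∈ vset Y := by
    by_contra! hno
    obtain ⟨e, heX, heY⟩ := Finset.not_subset.1 hXY
    obtain ⟨v, hve, y, hy, hr⟩ := hmeet e heX
    refine hno e heX heY v hve (mem_of_reachable ?_ hr.symm hy)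
    intro a b hab ha
    rw [SimpleGraph.fromEdgeSet_adj] at hab
    have habX : s(a, b) ∈ X := by exact_mod_cast hab.1
    by_cases habY : s(a, b) ∈ Y
    · exact mem_vset habY (Sym2.mem_mk_right a b)
    · exact absurd ha (hno _ habX habY a (Sym2.mem_mk_left a b))
  obtain ⟨e, heX, heY, v, hve, hv⟩ := hex
  have hlt : (X \ insert e Y).card < (X \ Y).card := by
    apply Finset.card_lt_card
    rw [Finset.ssubset_iff_of_subset
      (Finset.sdiff_subset_sdiff subset_rfl (Finset.subset_insert _ _))]
    exact ⟨e, by simp [heX, heY], by simp⟩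
  refine (Delta_one_le_of_meets (Y := insert e Y) (Finset.insert_subset heX hYX) ?_).trans
    (Delta_one_insert_le heY hve hv)
  intro e' he'
  obtain ⟨v', hv', y, hy, hr⟩ := hmeet e' he'
  exact ⟨v', hv', y, vset_mono (Finset.subset_insert _ _) hy, hr⟩
termination_by (X \ Y).card

lemma Delta_one_le_add_elimS {X C D : Finset (Sym2 V)} (hC : C ⊆ X) (hD : D ⊆ X) :
    Delta (fun _ => 1) X ≤ Delta (fun _ => 1) D + Delta (fun _ => 1) (elimS C (vset D)) +
      Delta (fun _ => 1) (elimS X (vset C ∪ vset D)) := by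
  have h1 : Disjoint D (elimS C (vset D)) := disjoint_elimS subset_rfl
  have h2 : Disjoint (D ∪ elimS C (vset D)) (elimS X (vset C ∪ vset D)) := by
    apply disjoint_elimS
    rw [vset_union]
    exact Set.union_subset Set.subset_union_right
      ((vset_mono (elimS_subset _ _)).trans Set.subset_union_left)
  refine le_trans ?_ ((Delta_one_union_le h2).trans
    (add_le_add_left (Delta_one_union_le h1) _))
  refine Delta_one_le_of_meets (Finset.union_subset
    (Finset.union_subset hD ((elimS_subset _ _).trans hC)) (elimS_subset _ _)) ?_
  intro e heX
  rw [vset_union, vset_union]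
  by_cases he : e ∈ elimS X (vset C ∪ vset D)
  · obtain ⟨v, hv⟩ := exists_mem_sym2 e
    exact ⟨v, hv, v, Or.inr (mem_vset he hv), SimpleGraph.Reachable.refl _⟩
  have he' : ∃ v ∈ e, ∃ s ∈ vset C ∪ vset D,
      (SimpleGraph.fromEdgeSet (X : Set (Sym2 V))).Reachable v s := by
    by_contra! hno
    exact he (Finset.mem_filter.2 ⟨heX, hno⟩)
  obtain ⟨v, hv, s, hs | hs, hr⟩ := he'
  · obtain ⟨c, hc, hsc⟩ := hs
    by_cases hcD : c ∈ elimS C (vset D)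
    · exact ⟨v, hv, s, Or.inl (Or.inr (mem_vset hcD hsc)), hr⟩
    have hc' : ∃ v ∈ c, ∃ s ∈ vset D,
        (SimpleGraph.fromEdgeSet (C : Set (Sym2 V))).Reachable v s := by
      by_contra! hno
      exact hcD (Finset.mem_filter.2 ⟨hc, hno⟩)
    obtain ⟨v', hv', s', hs', hr'⟩ := hc'
    exact ⟨v, hv, s', Or.inl (Or.inl hs'),
      hr.trans ((reachable_of_mem (hC hc) hsc hv').trans (reachable_mono hC hr'))⟩
  · exact ⟨v, hv, s, Or.inl (Or.inl hs), hr⟩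

/-! ### Restricting to a union of connected components -/

/-- No edge of `X` inside `W` shares a vertex with an edge of `X` outside `W`, i.e. `X ∩ W` is a
union of connected components of `X`. -/
def Separates (X W : Finset (Sym2 V)) : Prop :=
  ∀ e ∈ X, e ∈ W → ∀ e' ∈ X, e' ∉ W → ∀ v ∈ e, v ∉ e'

lemma Separates.mono {X Y W : Finset (Sym2 V)} (h : Separates X W) (hY : Y ⊆ X) :
    Separates Y W :=
  fun e he heW e' he' he'W => h e (hY he) heW e' (hY he') he'W

lemma Separates.compl {X W : Finset (Sym2 V)} (h : Separates X W) : Separates X (X \ W) := by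
  intro e he heW e' he' he'W v hv hv'
  simp only [Finset.mem_sdiff, not_and, not_not] at heW he'W
  exact h e' he' (he'W he') e he heW.2 v hv' hv

lemma separates_elimS (X : Finset (Sym2 V)) (S : Set V) : Separates X (elimS X S) := by
  intro e _ heW e' he' he'W v hv hv'
  refine he'W (Finset.mem_filter.2 ⟨he', fun u hu s hs hr => ?_⟩)
  exact (Finset.mem_filter.1 heW).2 v hv s hs ((reachable_of_mem he' hv' hu).trans hr)

lemma Separates.reachable_inter {F W : Finset (Sym2 V)} (h : Separates F W) {u v : V}
    (hu : u ∈ vset (F ∩ W))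
    (huv : (SimpleGraph.fromEdgeSet (F : Set (Sym2 V))).Reachable u v) :
    v ∈ vset (F ∩ W) ∧
      (SimpleGraph.fromEdgeSet ((F ∩ W : Finset (Sym2 V)) : Set (Sym2 V))).Reachable u v := by
  refine mem_of_reachable (T := {x | x ∈ vset (F ∩ W) ∧
    (SimpleGraph.fromEdgeSet ((F ∩ W : Finset (Sym2 V)) : Set (Sym2 V))).Reachable u x}) ?_ huv
    ⟨hu, SimpleGraph.Reachable.refl _⟩
  rintro a b hab ⟨⟨e, he, hae⟩, hr⟩
  rw [SimpleGraph.fromEdgeSet_adj] at hab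
  have habF : s(a, b) ∈ F := by exact_mod_cast hab.1
  rw [Finset.mem_inter] at he
  have habW : s(a, b) ∈ W := by
    by_contra hW
    exact h e he.1 he.2 _ habF hW a hae (Sym2.mem_mk_left a b)
  have hmem := Finset.mem_inter.2 ⟨habF, habW⟩
  exact ⟨mem_vset hmem (Sym2.mem_mk_right a b),
    hr.trans (reachable_of_mem hmem (Sym2.mem_mk_left a b) (Sym2.mem_mk_right a b))⟩

lemma Separates.elimS_inter {X W F G : Finset (Sym2 V)} (h : Separates X W) (hF : F ⊆ X)
    (hG : G ⊆ X) : elimS (F ∩ W) (vset (G ∩ W)) = elimS F (vset G) ∩ W := by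
  ext e
  simp only [elimS, Finset.mem_filter, Finset.mem_inter]
  constructor
  · rintro ⟨⟨heF, heW⟩, hno⟩
    refine ⟨⟨heF, fun v hv s hs hr => ?_⟩, heW⟩
    obtain ⟨⟨e', he', hse'⟩, hr'⟩ :=
      (h.mono hF).reachable_inter (mem_vset (Finset.mem_inter.2 ⟨heF, heW⟩) hv) hr
    obtain ⟨g, hg, hsg⟩ := hs
    rw [Finset.mem_inter] at he'
    refine hno v hv s (mem_vset (Finset.mem_inter.2 ⟨hg, ?_⟩) hsg) hr'
    by_contra hgW
    exact h e' (hF he'.1) he'.2 g (hG hg) hgW s hse' hsg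
  · rintro ⟨⟨heF, hno⟩, heW⟩
    exact ⟨⟨heF, heW⟩, fun v hv s hs hr =>
      hno v hv s (vset_mono Finset.inter_subset_left hs)
        (reachable_mono Finset.inter_subset_left hr)⟩

lemma Separates.elimS_sdiff {X W F G : Finset (Sym2 V)} (h : Separates X W) (hF : F ⊆ X)
    (hG : G ⊆ X) : elimS (F \ W) (vset (G \ W)) = elimS F (vset G) \ W := by
  have key : ∀ H ⊆ X, H ∩ (X \ W) = H \ W := by
    intro H hH
    ext e
    simp only [Finset.mem_inter, Finset.mem_sdiff]
    exact ⟨fun he => ⟨he.1, he.2.2⟩, fun he => ⟨he.1, hH he.1, he.2⟩⟩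
  rw [← key F hF, ← key G hG, ← key _ ((elimS_subset _ _).trans hF)]
  exact h.compl.elimS_inter hF hG

lemma Separates.Delta_one_add_le {F W : Finset (Sym2 V)} (h : Separates F W) :
    Delta (fun _ => 1) (F ∩ W) + Delta (fun _ => 1) (F \ W) ≤ Delta (fun _ => 1) F := by
  have hdis : Disjoint (vset (F ∩ W)) (vset (F \ W)) := by
    rw [Set.disjoint_left]
    rintro v ⟨e, he, hv⟩ ⟨e', he', hv'⟩
    rw [Finset.mem_inter] at he
    rw [Finset.mem_sdiff] at he'
    exact h e he.1 he.2 e' he'.1 he'.2 v hv hv'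
  have hV : (vset (F ∩ W)).ncard + (vset (F \ W)).ncard ≤ (vset F).ncard := by
    rw [← Set.ncard_union_eq hdis (vset_finite _) (vset_finite _)]
    exact Set.ncard_le_ncard (Set.union_subset (vset_mono Finset.inter_subset_left)
      (vset_mono Finset.sdiff_subset)) (vset_finite _)
  have hE : (F ∩ W).card + (F \ W).card = F.card := Finset.card_inter_add_card_sdiff F W
  have hV' : ((vset (F ∩ W)).ncard : ℝ) + (vset (F \ W)).ncard ≤ (vset F).ncard := by
    exact_mod_cast hV
  have hE' : ((F ∩ W).card : ℝ) + (F \ W).card = F.card := by exact_mod_cast hE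
  rw [Delta_one, Delta_one, Delta_one]
  linarith

/-- The combined effect of restriction to `W` on the `Delta` terms of the constraints. -/
lemma Separates.Delta_one_elimS_le {X W C D : Finset (Sym2 V)} (h : Separates X W) (hC : C ⊆ X)
    (hD : D ⊆ X) :
    Delta (fun _ => 1) (elimS (X ∩ W) (vset (C ∩ W) ∪ vset (D ∩ W))) +
        Delta (fun _ => 1) (X \ W) ≤
      Delta (fun _ => 1) (D \ W) + Delta (fun _ => 1) (elimS C (vset D) \ W) +
        Delta (fun _ => 1) (elimS X (vset C ∪ vset D)) := by
  have h1 := Delta_one_le_add_elimS (Finset.sdiff_subset_sdiff hC (subset_refl W))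
    (Finset.sdiff_subset_sdiff hD (subset_refl W))
  have hCD : C ∪ D ⊆ X := Finset.union_subset hC hD
  have e1 : elimS (X ∩ W) (vset (C ∩ W) ∪ vset (D ∩ W)) = elimS X (vset C ∪ vset D) ∩ W := by
    rw [← vset_union, ← vset_union, ← Finset.union_inter_distrib_right,
      h.elimS_inter subset_rfl hCD]
  have e2 : elimS (X \ W) (vset (C \ W) ∪ vset (D \ W)) = elimS X (vset C ∪ vset D) \ W := by
    rw [← vset_union, ← vset_union, ← Finset.union_sdiff_distrib,
      h.elimS_sdiff subset_rfl hCD]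
  rw [h.elimS_sdiff hC hD, e2] at h1
  rw [e1]
  have h2 := (h.mono (elimS_subset X (vset C ∪ vset D))).Delta_one_add_le
  linarith

/-! ### Sub-join-trees and pruning -/

namespace JoinTree

/-- The number of internal nodes of a join-tree. -/
def numNodes : JoinTree V → ℕ
  | leaf _ => 0
  | node B C => numNodes B + numNodes C + 1

lemma Sub.numNodes_le {D A : JoinTree V} (h : Sub D A) : D.numNodes ≤ A.numNodes := by
  induction h with
  | empty => simp [numNodes]
  | refl => exact le_rfl
  | left _ ih => simp only [numNodes]; omega
  | right _ ih => simp only [numNodes]; omega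

lemma sub_leaf {D : JoinTree V} {l : Option (Sym2 V)} (h : Sub D (leaf l)) :
    D = leaf none ∨ D = leaf l := by
  cases h with
  | empty => exact Or.inl rfl
  | refl => exact Or.inr rfl

lemma SubP.numNodes_lt {D B C : JoinTree V} (h : SubP D (node B C)) :
    D.numNodes < (node B C).numNodes := by
  obtain ⟨h, hne⟩ := h
  cases h with
  | empty => simp [numNodes]
  | refl => exact absurd rfl hne
  | left h => have := h.numNodes_le; simp only [numNodes]; omega
  | right h => have := h.numNodes_le; simp only [numNodes]; omega

lemma finite_sub (A : JoinTree V) : {D | Sub D A}.Finite := by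
  induction A with
  | leaf l =>
    refine (Set.toFinite {leaf none, leaf l}).subset fun D hD => ?_
    simpa using sub_leaf hD
  | node B C hB hC =>
    refine ((hB.union hC).union (Set.toFinite {leaf none, node B C})).subset fun D hD => ?_
    cases hD with
    | empty => simp
    | refl => simp
    | left h => exact Or.inl (Or.inl h)
    | right h => exact Or.inl (Or.inr h)

lemma numNodes_prune (A : JoinTree V) (W : Finset (Sym2 V)) :
    (prune A W).numNodes = A.numNodes := by
  induction A with
  | leaf l =>
    cases l with
    | none => rfl
    | some e => simp only [prune]; split_ifs <;> rfl
  | node B C hB hC => simp [prune, numNodes, hB, hC]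

lemma numNodes_elimT (A : JoinTree V) (S : Set V) : (elimT A S).numNodes = A.numNodes :=
  numNodes_prune _ _

lemma graph_prune (A : JoinTree V) (W : Finset (Sym2 V)) :
    (prune A W).graph = A.graph ∩ W := by
  induction A with
  | leaf l =>
    cases l with
    | none => simp [prune, graph]
    | some e =>
      simp only [prune]
      split_ifs with h
      · simp [graph, h]
      · simp [graph, h]
  | node B C hB hC => simp [prune, graph, hB, hC, Finset.union_inter_distrib_right]

lemma prune_prune (A : JoinTree V) (U W : Finset (Sym2 V)) :
    prune (prune A U) W = prune A (U ∩ W) := by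
  induction A with
  | leaf l =>
    cases l with
    | none => rfl
    | some e =>
      by_cases hU : e ∈ U <;> by_cases hW : e ∈ W <;> simp [prune, hU, hW]
  | node B C hB hC => simp [prune, hB, hC]

lemma exists_sub_of_sub_prune {A D' : JoinTree V} {W : Finset (Sym2 V)}
    (h : Sub D' (prune A W)) : ∃ D, Sub D A ∧ D' = prune D W := by
  induction A with
  | leaf l =>
    have : ∃ m, prune (leaf l) W = leaf m := by
      cases l with
      | none => exact ⟨none, rfl⟩
      | some e => simp only [prune]; split_ifs <;> exact ⟨_, rfl⟩
    obtain ⟨m, hm⟩ := this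
    rw [hm] at h
    rcases sub_leaf h with rfl | rfl
    · exact ⟨leaf none, Sub.empty _, rfl⟩
    · exact ⟨leaf l, Sub.refl _, hm.symm⟩
  | node B C hB hC =>
    simp only [prune] at h
    cases h with
    | empty => exact ⟨leaf none, Sub.empty _, rfl⟩
    | refl => exact ⟨node B C, Sub.refl _, rfl⟩
    | left h =>
      obtain ⟨D, hD, rfl⟩ := hB h
      exact ⟨D, hD.left, rfl⟩
    | right h =>
      obtain ⟨D, hD, rfl⟩ := hC h
      exact ⟨D, hD.right, rfl⟩

lemma exists_subP_of_subP_prune {A D' : JoinTree V} {W : Finset (Sym2 V)}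
    (h : SubP D' (prune A W)) : ∃ D, SubP D A ∧ D' = prune D W := by
  obtain ⟨D, hD, rfl⟩ := exists_sub_of_sub_prune h.1
  exact ⟨D, ⟨hD, fun hDA => h.2 (by rw [hDA])⟩, rfl⟩

lemma elimT_prune {X W : Finset (Sym2 V)} (h : Separates X W) {D E' : JoinTree V}
    (hD : D.graph ⊆ X) (hE' : E'.graph ⊆ X) :
    elimT (prune E' W) (vset (prune D W).graph) = prune (elimT E' (vset D.graph)) W := by
  rw [elimT, elimT, graph_prune, graph_prune, h.elimS_inter hE' hD, prune_prune, prune_prune]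
  congr 1
  ext e
  simp only [Finset.mem_inter]
  tauto

lemma graph_elimT (A : JoinTree V) (S : Set V) : (elimT A S).graph = Paper.elimS A.graph S := by
  rw [elimT, graph_prune]
  exact Finset.inter_eq_right.2 (elimS_subset _ _)

lemma Over.of_subset {E : Set (Sym2 V)} {A D : JoinTree V} (h : Over E A)
    (hD : D.graph ⊆ A.graph) : Over E D :=
  fun _ he => h (hD he)

end JoinTree

/-! ### A recursive description of the potential function -/

/-- The lower bounds on `f A` given by (†) when `A` has children `B` and `C`. -/
def daggerValues (θ : Sym2 V → ℝ) (f : JoinTree V → ℝ) (A B C : JoinTree V) : Set ℝ :=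
  (fun D => f D + Delta θ (elimS C.graph (vset D.graph)) +
    Delta θ (elimS A.graph (vset C.graph ∪ vset D.graph))) '' {D | Sub D B}

/-- The lower bounds on `f A` given by (‡). -/
def ddaggerValues (θ : Sym2 V → ℝ) (f : JoinTree V → ℝ) (A : JoinTree V) : Set ℝ :=
  (fun p : JoinTree V × JoinTree V =>
    (f p.1 + f (elimT p.2 (vset p.1.graph)) + Delta θ A.graph +
      Delta θ (elimS A.graph (vset p.1.graph ∪ vset p.2.graph))) / 2) ''
    ({D | SubP D A} ×ˢ {D | SubP D A})

/-- All the lower bounds on `f ⟨B, C⟩`. -/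
def boundValues (θ : Sym2 V → ℝ) (f : JoinTree V → ℝ) (B C : JoinTree V) : Set ℝ :=
  daggerValues θ f (node B C) B C ∪ daggerValues θ f (node B C) C B ∪
    ddaggerValues θ f (node B C)

lemma finite_boundValues (θ : Sym2 V → ℝ) (f : JoinTree V → ℝ) (B C : JoinTree V) :
    (boundValues θ f B C).Finite := by
  have h : {D | SubP D (node B C)}.Finite :=
    (finite_sub (node B C)).subset fun D hD => hD.1
  exact (((finite_sub B).image _).union ((finite_sub C).image _)).union ((h.prod h).image _)

lemma boundValues_nonempty (θ : Sym2 V → ℝ) (f : JoinTree V → ℝ) (B C : JoinTree V) :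
    (boundValues θ f B C).Nonempty :=
  ⟨_, Or.inl (Or.inl ⟨leaf none, Sub.empty B, rfl⟩)⟩

lemma boundValues_congr (θ : Sym2 V → ℝ) {f g : JoinTree V → ℝ} {B C : JoinTree V}
    (h : ∀ D, D.numNodes < (node B C).numNodes → f D = g D) :
    boundValues θ f B C = boundValues θ g B C := by
  unfold boundValues daggerValues ddaggerValues
  congr 1
  · congr 1
    · refine Set.image_congr fun D hD => ?_
      have := Sub.numNodes_le hD
      rw [h D (by simp only [numNodes]; omega)]
    · refine Set.image_congr fun D hD => ?_
      have := Sub.numNodes_le hD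
      rw [h D (by simp only [numNodes]; omega)]
  · refine Set.image_congr fun p hp => ?_
    rw [h p.1 hp.1.numNodes_lt, h (elimT _ _) (by
      rw [numNodes_elimT]; exact hp.2.numNodes_lt)]

/-- There is a function equal to `Delta` on leaves and to the largest lower bound on nodes. -/
lemma exists_recursive (θ : Sym2 V → ℝ) : ∃ R : JoinTree V → ℝ,
    (∀ l, R (leaf l) = Delta θ (leaf l).graph) ∧
    ∀ B C, R (node B C) = sSup (boundValues θ R B C) := by
  let wf : WellFounded (InvImage (· < ·) (numNodes (V := V))) := InvImage.wf _ wellFounded_lt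
  let step : (A : JoinTree V) →
      ((A' : JoinTree V) → InvImage (· < ·) numNodes A' A → ℝ) → ℝ := fun A =>
    match A with
    | leaf l => fun _ => Delta θ (leaf l).graph
    | node B C => fun r => sSup (boundValues θ
        (fun A' => if h : A'.numNodes < (node B C).numNodes then r A' h else 0) B C)
  refine ⟨wf.fix step, fun l => ?_, fun B C => ?_⟩
  · rw [wf.fix_eq]
  · rw [wf.fix_eq]
    change sSup _ = _
    rw [boundValues_congr θ (g := wf.fix step)]
    intro D hD
    exact dif_pos hD

section Recursive

variable {E : Set (Sym2 V)} {θ : Sym2 V → ℝ} {R : JoinTree V → ℝ}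

lemma mem_boundValues_of_recursive
    (hnode : ∀ B C, R (node B C) = sSup (boundValues θ R B C)) (B C : JoinTree V) :
    R (node B C) ∈ boundValues θ R B C := by
  rw [hnode]
  exact (boundValues_nonempty θ R B C).csSup_mem (finite_boundValues θ R B C)

lemma le_of_mem_boundValues
    (hnode : ∀ B C, R (node B C) = sSup (boundValues θ R B C)) {B C : JoinTree V} {y : ℝ}
    (hy : y ∈ boundValues θ R B C) : y ≤ R (node B C) := by
  rw [hnode]
  exact le_csSup (finite_boundValues θ R B C).bddAbove hy

lemma phiOk_of_recursive
    (hE : ∀ F : Finset (Sym2 V), (F : Set (Sym2 V)) ⊆ E → 0 ≤ Delta θ F)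
    (hleaf : ∀ l, R (leaf l) = Delta θ (leaf l).graph)
    (hnode : ∀ B C, R (node B C) = sSup (boundValues θ R B C)) : PhiOk E θ R := by
  have hnone : R (leaf none) = 0 := by rw [hleaf]; simp [graph]
  refine ⟨?_, ?_, ?_, ?_, ?_⟩
  · intro A hA
    cases A with
    | leaf l => rw [hleaf]; exact hE _ hA
    | node B C =>
      have h := le_of_mem_boundValues hnode
        (Or.inl (Or.inl ⟨leaf none, Sub.empty B, rfl⟩) : _ ∈ boundValues θ R B C)
      refine le_trans ?_ h
      have h1 : 0 ≤ Delta θ (elimS C.graph (vset (leaf none : JoinTree V).graph)) :=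
        hE _ fun e he => hA (Finset.mem_union_right _ (elimS_subset _ _ he))
      have h2 : 0 ≤ Delta θ (elimS (node B C).graph
          (vset C.graph ∪ vset (leaf none : JoinTree V).graph)) :=
        hE _ fun e he => hA (elimS_subset _ _ he)
      dsimp only
      linarith
  · rintro A - ⟨l, rfl⟩
    exact (hleaf l).ge
  · intro B C D _ hD
    exact le_of_mem_boundValues hnode (Or.inl (Or.inl ⟨D, hD, rfl⟩))
  · intro B C D _ hD
    exact le_of_mem_boundValues hnode (Or.inl (Or.inr ⟨D, hD, rfl⟩))
  · intro A D E' _ hD hE'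
    cases A with
    | leaf l =>
      obtain rfl : D = leaf none := (sub_leaf hD.1).resolve_right hD.2
      obtain rfl : E' = leaf none := (sub_leaf hE'.1).resolve_right hE'.2
      have : elimT (leaf none : JoinTree V) (vset (leaf none : JoinTree V).graph) = leaf none :=
        rfl
      rw [this, hnone, hleaf]
      have : vset (leaf none : JoinTree V).graph = ∅ := by simp [graph]
      rw [this, Set.union_empty, elimS_empty]
      linarith
    | node B C =>
      exact le_of_mem_boundValues hnode (Or.inr ⟨(D, E'), ⟨hD, hE'⟩, rfl⟩)

lemma recursive_le_of_phiOk
    (hleaf : ∀ l, R (leaf l) = Delta θ (leaf l).graph)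
    (hnode : ∀ B C, R (node B C) = sSup (boundValues θ R B C))
    {f : JoinTree V → ℝ} (hf : PhiOk E θ f) (A : JoinTree V) (hA : Over E A) : R A ≤ f A := by
  obtain ⟨-, hatom, hdag, hdag', hddag⟩ := hf
  induction hn : A.numNodes using Nat.strong_induction_on generalizing A with
  | _ n ih =>
  subst hn
  cases A with
  | leaf l => rw [hleaf]; exact hatom _ hA ⟨l, rfl⟩
  | node B C =>
    rcases mem_boundValues_of_recursive hnode B C with
      (⟨D, hD, hy⟩ | ⟨D, hD, hy⟩) | ⟨⟨D, E'⟩, ⟨hD, hE'⟩, hy⟩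
    · have := Sub.numNodes_le hD
      have := ih _ (by simp only [numNodes]; omega) D
        (hA.of_subset (graph_mono_of_sub (Sub.left hD))) rfl
      have := hdag B C D hA hD
      dsimp only at hy
      linarith
    · have := Sub.numNodes_le hD
      have := ih _ (by simp only [numNodes]; omega) D
        (hA.of_subset (graph_mono_of_sub (Sub.right hD))) rfl
      have := hdag' B C D hA hD
      dsimp only at hy
      linarith
    · have h1 := ih _ (SubP.numNodes_lt hD) D (hA.of_subset (graph_mono_of_sub hD.1)) rfl
      have h2 := ih _ ((numNodes_elimT E' (vset D.graph)).trans_lt (SubP.numNodes_lt hE'))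
        (elimT E' (vset D.graph)) (hA.of_subset (by
          rw [graph_elimT]
          exact (elimS_subset _ _).trans (graph_mono_of_sub hE'.1))) rfl
      have := hddag _ D E' hA hD hE'
      dsimp only at hy
      linarith

lemma Phi_eq_recursive
    (hE : ∀ F : Finset (Sym2 V), (F : Set (Sym2 V)) ⊆ E → 0 ≤ Delta θ F)
    (hleaf : ∀ l, R (leaf l) = Delta θ (leaf l).graph)
    (hnode : ∀ B C, R (node B C) = sSup (boundValues θ R B C))
    {A : JoinTree V} (hA : Over E A) : Phi E θ A = R A := by
  have hR := phiOk_of_recursive hE hleaf hnode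
  refine IsLeast.csInf_eq ⟨⟨R, hR, rfl⟩, ?_⟩
  rintro y ⟨f, hf, rfl⟩
  exact recursive_le_of_phiOk hleaf hnode hf A hA

end Recursive

/-- Removing a union of components from a join-tree lowers the potential by at least the
number of components removed. -/
lemma recursive_prune_add_Delta_le {R : JoinTree V → ℝ}
    (hleaf : ∀ l, R (leaf l) = Delta (fun _ => 1) (leaf l).graph)
    (hnode : ∀ B C, R (node B C) = sSup (boundValues (fun _ => 1) R B C))
    (W : Finset (Sym2 V)) (A : JoinTree V) (hW : Separates A.graph W) :
    R (prune A W) + Delta (fun _ => 1) (A.graph \ W) ≤ R A := by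
  induction hn : A.numNodes using Nat.strong_induction_on generalizing A with
  | _ n ih =>
  subst hn
  cases A with
  | leaf l =>
    have : ∃ m, prune (leaf l) W = leaf m := by
      cases l with
      | none => exact ⟨none, rfl⟩
      | some e => simp only [prune]; split_ifs <;> exact ⟨_, rfl⟩
    obtain ⟨m, hm⟩ := this
    rw [hm, hleaf, hleaf, ← hm, graph_prune]
    exact hW.Delta_one_add_le
  | node B C =>
    have hdagger : ∀ B' C' D : JoinTree V, C'.graph ⊆ (node B C).graph →
        Sub B' (node B C) → D.numNodes < (node B C).numNodes → Sub D B' →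
        R (prune D W) + Delta (fun _ => 1) (elimS (prune C' W).graph (vset (prune D W).graph)) +
          Delta (fun _ => 1) (elimS (prune (node B C) W).graph
            (vset (prune C' W).graph ∪ vset (prune D W).graph)) +
          Delta (fun _ => 1) ((node B C).graph \ W) ≤
        R D + Delta (fun _ => 1) (elimS C'.graph (vset D.graph)) +
          Delta (fun _ => 1) (elimS (node B C).graph (vset C'.graph ∪ vset D.graph)) := by
      intro B' C' D hC' hB' hlt hD
      have hDA : D.graph ⊆ (node B C).graph :=
        (graph_mono_of_sub hD).trans (graph_mono_of_sub hB')
      have h1 := ih _ hlt D (hW.mono hDA) rfl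
      have h2 := hW.Delta_one_elimS_le hC' hDA
      have h3 := (hW.mono ((elimS_subset C'.graph (vset D.graph)).trans hC')).Delta_one_add_le
      rw [graph_prune, graph_prune, graph_prune, hW.elimS_inter hC' hDA]
      linarith
    have htight : R (prune (node B C) W) ∈ boundValues (fun _ => 1) R (prune B W) (prune C W) :=
      mem_boundValues_of_recursive hnode _ _
    rcases htight with (⟨D', hD', hy⟩ | ⟨D', hD', hy⟩) | ⟨⟨D', E'⟩, ⟨hD', hE'⟩, hy⟩
    · obtain ⟨D, hD, rfl⟩ := exists_sub_of_sub_prune hD'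
      have hlt := Sub.numNodes_le hD
      have h1 := hdagger B C D Finset.subset_union_right (Sub.left (Sub.refl B))
        (by simp only [numNodes]; omega) hD
      have h2 := le_of_mem_boundValues hnode
        (Or.inl (Or.inl ⟨D, hD, rfl⟩) : _ ∈ boundValues _ R B C)
      rw [← hy]
      exact h1.trans h2
    · obtain ⟨D, hD, rfl⟩ := exists_sub_of_sub_prune hD'
      have hlt := Sub.numNodes_le hD
      have h1 := hdagger C B D Finset.subset_union_left (Sub.right (Sub.refl C))
        (by simp only [numNodes]; omega) hD
      have h2 := le_of_mem_boundValues hnode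
        (Or.inl (Or.inr ⟨D, hD, rfl⟩) : _ ∈ boundValues _ R B C)
      rw [← hy]
      exact h1.trans h2
    · obtain ⟨D, hD, rfl⟩ := exists_subP_of_subP_prune (A := node B C) hD'
      obtain ⟨F, hF, rfl⟩ := exists_subP_of_subP_prune (A := node B C) hE'
      have hDA := graph_mono_of_sub hD.1
      have hFA := graph_mono_of_sub hF.1
      have hFD : (elimT F (vset D.graph)).graph ⊆ (node B C).graph := by
        rw [graph_elimT]
        exact (elimS_subset _ _).trans hFA
      have h1 := ih _ hD.numNodes_lt D (hW.mono hDA) rfl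
      have h2 := ih _ ((numNodes_elimT F (vset D.graph)).trans_lt hF.numNodes_lt)
        (elimT F (vset D.graph)) (hW.mono hFD) rfl
      have h3 := hW.Delta_one_elimS_le hFA hDA
      have h4 := hW.Delta_one_add_le
      have h5 := le_of_mem_boundValues hnode
        (Or.inr ⟨(D, F), ⟨hD, hF⟩, rfl⟩ : _ ∈ boundValues _ R B C)
      have e : node (prune B W) (prune C W) = prune (node B C) W := rfl
      dsimp only at hy h5
      rw [elimT_prune hW hDA hFA, e, graph_prune, graph_prune, graph_prune, Set.union_comm] at hy
      rw [Set.union_comm] at h5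
      rw [graph_elimT] at h2
      linarith

/-! ### Counting components on the path -/

lemma natCast_le_Delta_one {F : Finset (Sym2 ℤ)} (hF : (F : Set (Sym2 ℤ)) ⊆ EPinf) {t : ℕ}
    (f : Fin t → ℤ) (hf : ∀ i, f i ∈ vset F)
    (hdist : ∀ i j, i ≠ j →
      ¬ (SimpleGraph.fromEdgeSet (F : Set (Sym2 ℤ))).Reachable (f i) (f j)) :
    (t : ℝ) ≤ Delta (fun _ => 1) F := by
  have hmin : ∀ i, ∃ m ∈ vset F, s(m - 1, m) ∉ F ∧
      (SimpleGraph.fromEdgeSet (F : Set (Sym2 ℤ))).Reachable (f i) m := by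
    intro i
    let T : Set ℤ := {m | m ∈ vset F ∧
      (SimpleGraph.fromEdgeSet (F : Set (Sym2 ℤ))).Reachable (f i) m}
    have hT : T.Finite := (vset_finite F).subset fun m hm => hm.1
    obtain ⟨m, hm, hmmin⟩ := T.exists_min_image id hT ⟨f i, hf i, SimpleGraph.Reachable.refl _⟩
    refine ⟨m, hm.1, fun hmem => ?_, hm.2⟩
    have := hmmin (m - 1) ⟨mem_vset hmem (Sym2.mem_mk_left _ _),
      hm.2.trans (reachable_of_mem hmem (Sym2.mem_mk_right _ _) (Sym2.mem_mk_left _ _))⟩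
    simp only [id] at this
    omega
  choose g hgV hgF hgr using hmin
  have hginj : Function.Injective g := by
    intro i j hij
    by_contra hne
    exact hdist i j hne ((hgr i).trans (hij ▸ (hgr j).symm))
  let right : Set ℤ := {m | s(m - 1, m) ∈ F}
  have hright : right.ncard = F.card := by
    rw [← Set.ncard_coe_finset]
    refine Set.ncard_congr (fun m _ => s(m - 1, m)) (fun m hm => hm) ?_ ?_
    · intro a b _ _ hab
      simp only [Sym2.eq_iff] at hab
      omega
    · intro e he
      obtain ⟨i, rfl⟩ := hF he
      refine ⟨i + 1, ?_, ?_⟩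
      · simpa [right] using he
      · simp
  have hsub : right ∪ Set.range g ⊆ vset F := by
    rintro m (hm | ⟨i, rfl⟩)
    · exact mem_vset hm (Sym2.mem_mk_right _ _)
    · exact hgV i
  have hdis : Disjoint right (Set.range g) := by
    rw [Set.disjoint_left]
    rintro m hm ⟨i, rfl⟩
    exact hgF i hm
  have hcard := Set.ncard_le_ncard hsub (vset_finite F)
  have hrfin : right.Finite := (vset_finite F).subset (Set.subset_union_left.trans hsub)
  rw [Set.ncard_union_eq hdis hrfin (Set.finite_range g), hright,
    ← Set.image_univ, Set.ncard_image_of_injective _ hginj, Set.ncard_univ,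
    Nat.card_eq_fintype_card, Fintype.card_fin] at hcard
  have hcard' : (F.card : ℝ) + t ≤ (vset F).ncard := by exact_mod_cast hcard
  rw [Delta_one]
  linarith

/-- For every join-tree `A` over `P_∞` and finite `S ⊆ ℤ`, if `S`
intersects `t` distinct connected components of `Gr(A)`, then
`Φ(A) ≥ Φ(A ⊖ S) + t`. -/
theorem stmt19 (A : JoinTree ℤ) (hover : Over EPinf A) (S : Set ℤ) (hS : S.Finite)
    (t : ℕ) (f : Fin t → ℤ)
    (hf : ∀ i : Fin t, f i ∈ S ∧ f i ∈ vset A.graph)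
    (hdist : ∀ i j : Fin t, i ≠ j →
      ¬ (SimpleGraph.fromEdgeSet (A.graph : Set (Sym2 ℤ))).Reachable (f i) (f j)) :
    Phi EPinf theta1 (elimT A S) + (t : ℝ) ≤ Phi EPinf theta1 A := by
  have htheta : theta1 = fun _ => 1 := rfl
  have hE : ∀ F : Finset (Sym2 ℤ), (F : Set (Sym2 ℤ)) ⊆ EPinf →
      0 ≤ Delta (fun _ => 1) F := by
    intro F hF
    have h := natCast_le_Delta_one hF (t := 0) Fin.elim0 (fun i => i.elim0) (fun i => i.elim0)
    rwa [Nat.cast_zero] at h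
  obtain ⟨R, hleaf, hnode⟩ := exists_recursive (fun _ : Sym2 ℤ => (1 : ℝ))
  have hover' : Over EPinf (elimT A S) :=
    hover.of_subset (by rw [graph_elimT]; exact elimS_subset _ _)
  rw [htheta, Phi_eq_recursive hE hleaf hnode hover, Phi_eq_recursive hE hleaf hnode hover']
  have hmain := recursive_prune_add_Delta_le hleaf hnode (elimS A.graph S) A
    (separates_elimS A.graph S)
  refine le_trans (add_le_add_right ?_ _) hmain
  have hsub := sdiff_elimS_subset A.graph S
  exact natCast_le_Delta_one (hover.trans' (Finset.coe_subset.2 hsub)) f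
    (fun i => mem_vset_sdiff_elimS (hf i).1 (hf i).2)
    (fun i j hij hr => hdist i j hij (reachable_mono hsub hr))

end Paper

end
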